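/- arXiv:2205.05995 — 2 statements merged into one kernel-verified Lean document; each statement's English description precedes it below -/
import Mathlib

section
/- If every connective in C is supermultiplicative, then every sequent over C that is valid in all constant domain Kripke models is valid in all Kripke models; equivalently, if some sequent Γ ⇒ Δ over C fails at some world of some Kripke model, then it fails at some world of some constant domain Kripke model. -/
open Classical

open Classical

/-- A signature: a set of propositional connectives, each with an arity and a
truth function `{0,1}^arity → {0,1}` (represented with `Bool`). -/
structure Signature : Type 1 where
  Conn : Type
  arity : Conn → ℕ
  tt : (c : Conn) → (Fin (arity c) → Bool) → Bool

/-- Predicate symbols: for each pair `(k, n)` a predicate symbol of arity `n`. -/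
abbrev PredSym : Type := ℕ × ℕ

/-- The arity of a predicate symbol. -/
abbrev parity (p : PredSym) : ℕ := p.2

/-- Predicate formulas over a signature: atomic formulas `p(x₁,…,xₙ)` (with
individual variables drawn from `ℕ`), applications of connectives, and the
quantifiers `∀x`, `∃x`. -/
inductive Formula (sig : Signature) : Type where
  | atom (p : PredSym) (args : Fin (parity p) → ℕ)
  | conn (c : sig.Conn) (args : Fin (sig.arity c) → Formula sig)
  | all (x : ℕ) (φ : Formula sig)
  | ex (x : ℕ) (φ : Formula sig)

/-- A Kripke model with worlds `W` and individuals drawn from `U`. -/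
structure Kripke (sig : Signature) (W U : Type) : Type where
  le : W → W → Prop
  le_refl : ∀ w, le w w
  le_trans : ∀ {w v u}, le w v → le v u → le w u
  D : W → Set U
  D_nonempty : ∀ w, (D w).Nonempty
  D_mono : ∀ {w v}, le w v → D w ⊆ D v
  I : (w : W) → (p : PredSym) → (Fin (parity p) → U) → Bool
  hered : ∀ {w v}, le w v → ∀ (p : PredSym) (a : Fin (parity p) → U),
      (∀ i, a i ∈ D w) → I w p a ≤ I v p a

/-- The value `‖φ‖_{K,w}^ρ ∈ {0,1}` of a formula at a world under an assignment. -/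
noncomputable def val {sig : Signature} {W U : Type} (K : Kripke sig W U) :
    Formula sig → W → (ℕ → U) → Bool
  | .atom p args, w, ρ => K.I w p (fun i => ρ (args i))
  | .conn c args, w, ρ =>
      decide (∀ v, K.le w v → sig.tt c (fun i => val K (args i) v ρ) = true)
  | .all x φ, w, ρ =>
      decide (∀ v, K.le w v → ∀ a ∈ K.D v, val K φ v (Function.update ρ x a) = true)
  | .ex x φ, w, ρ =>
      decide (∃ a ∈ K.D w, val K φ w (Function.update ρ x a) = true)

/-- A sequent `Γ ⇒ Δ` (two sets of formulas) is valid in a Kripke model if at no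
world and assignment do all formulas of `Γ` get value 1 and all formulas of `Δ`
get value 0. -/
def SeqValid {sig : Signature} {W U : Type} (K : Kripke sig W U)
    (Γ Δ : Set (Formula sig)) : Prop :=
  ∀ (w : W) (ρ : ℕ → U), (∀ x, ρ x ∈ K.D w) →
    ¬ ((∀ φ ∈ Γ, val K φ w ρ = true) ∧ (∀ φ ∈ Δ, val K φ w ρ = false))

/-- A Kripke model has constant domains if all worlds have the same domain. -/
def ConstantDomain {sig : Signature} {W U : Type} (K : Kripke sig W U) : Prop :=
  ∀ w v, K.D w = K.D v

/-- `Γ ⇒ Δ` is Kripke-valid (belongs to FOILS). -/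
def FOILS (sig : Signature) (Γ Δ : Set (Formula sig)) : Prop :=
  ∀ (W U : Type) (K : Kripke sig W U), SeqValid K Γ Δ

/-- `Γ ⇒ Δ` is valid in all constant domain Kripke models (belongs to FOCDS). -/
def FOCDS (sig : Signature) (Γ Δ : Set (Formula sig)) : Prop :=
  ∀ (W U : Type) (K : Kripke sig W U), ConstantDomain K → SeqValid K Γ Δ

/-- `Γ ⇒ Δ` is valid in all one-world Kripke models, i.e. classically valid
(belongs to FOCLS). -/
def FOCLS (sig : Signature) (Γ Δ : Set (Formula sig)) : Prop :=
  ∀ (U : Type) (K : Kripke sig Unit U), SeqValid K Γ Δ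

/-- A truth function is supermultiplicative if `f(a) = f(b) = 1` implies
`f(a ⊓ b) = 1`, where `⊓` is the componentwise minimum. -/
def Supermultiplicative {n : ℕ} (f : (Fin n → Bool) → Bool) : Prop :=
  ∀ a b : Fin n → Bool, f a = true → f b = true → f (fun i => a i && b i) = true

/-- A truth function is monotonic if `a ⊑ b` (componentwise) implies `f a ≤ f b`. -/
def Monotonic {n : ℕ} (f : (Fin n → Bool) → Bool) : Prop :=
  ∀ a b : Fin n → Bool, (∀ i, a i ≤ b i) → f a ≤ f b


namespace Formula

/-- The variables occurring in a formula, free or bound. -/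
noncomputable def vars {sig : Signature} : Formula sig → Finset ℕ
  | .atom _ args => Finset.univ.image args
  | .conn _ args => Finset.univ.biUnion fun i => vars (args i)
  | .all x φ => insert x (vars φ)
  | .ex x φ => insert x (vars φ)

end Formula

theorem val_congr {sig : Signature} {W U : Type} (K : Kripke sig W U) (φ : Formula sig) :
    ∀ (w : W) (ρ ρ' : ℕ → U), (∀ x ∈ φ.vars, ρ x = ρ' x) → val K φ w ρ = val K φ w ρ' := by
  induction φ with
  | atom p args =>
    intro w ρ ρ' h
    simp only [val]
    congr 1
    funext i
    exact h _ (by simp [Formula.vars])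
  | conn c args ih =>
    intro w ρ ρ' h
    have hargs : ∀ v i, val K (args i) v ρ = val K (args i) v ρ' := fun v i =>
      ih i v ρ ρ' fun x hx => h x (by simpa [Formula.vars] using ⟨i, hx⟩)
    simp only [val, hargs]
  | all x φ ih =>
    intro w ρ ρ' h
    have hupd : ∀ v a, val K φ v (Function.update ρ x a) = val K φ v (Function.update ρ' x a) := by
      intro v a
      refine ih v _ _ fun y hy => ?_
      rcases eq_or_ne y x with rfl | hne
      · simp
      · simpa [hne] using h y (by simp [Formula.vars, hy])
    simp only [val, hupd]
  | ex x φ ih =>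
    intro w ρ ρ' h
    have hupd : ∀ v a, val K φ v (Function.update ρ x a) = val K φ v (Function.update ρ' x a) := by
      intro v a
      refine ih v _ _ fun y hy => ?_
      rcases eq_or_ne y x with rfl | hne
      · simp
      · simpa [hne] using h y (by simp [Formula.vars, hy])
    simp only [val, hupd]

theorem update_mem {U : Type} {A : Set U} {ρ : ℕ → U} (hρ : ∀ x, ρ x ∈ A) (x : ℕ) {a : U}
    (ha : a ∈ A) (y : ℕ) : Function.update ρ x a y ∈ A := by
  rcases eq_or_ne y x with rfl | hne
  · simpa using ha
  · simpa [hne] using hρ y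

theorem val_mono {sig : Signature} {W U : Type} (K : Kripke sig W U) (φ : Formula sig) :
    ∀ {w v : W} {ρ : ℕ → U}, K.le w v → (∀ x, ρ x ∈ K.D w) →
      val K φ w ρ = true → val K φ v ρ = true := by
  induction φ with
  | atom p args =>
    intro w v ρ hwv hρ h
    exact K.hered hwv p _ (fun i => hρ (args i)) h
  | conn c args ih =>
    intro w v ρ hwv hρ h
    simp only [val, decide_eq_true_eq] at h ⊢
    exact fun u hvu => h u (K.le_trans hwv hvu)
  | all x φ ih =>
    intro w v ρ hwv hρ h
    simp only [val, decide_eq_true_eq] at h ⊢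
    exact fun u hvu => h u (K.le_trans hwv hvu)
  | ex x φ ih =>
    intro w v ρ hwv hρ h
    simp only [val, decide_eq_true_eq] at h ⊢
    obtain ⟨a, ha, hval⟩ := h
    exact ⟨a, K.D_mono hwv ha, ih hwv (update_mem hρ x ha) hval⟩

theorem val_mono_of_agree {sig : Signature} {W U : Type} (K : Kripke sig W U) (φ : Formula sig)
    {w v : W} {ρ ρ' : ℕ → U} (hwv : K.le w v) (hρ : ∀ x, ρ x ∈ K.D w)
    (hagree : ∀ x ∈ φ.vars, ρ' x = ρ x) (h : val K φ w ρ = true) : val K φ v ρ' = true :=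
  (val_congr K φ v ρ' ρ hagree).trans (val_mono K φ hwv hρ h)

/-- A supermultiplicative function is `1` at the pointwise infimum of any nonempty family of
vectors at which it is `1`. -/
theorem Supermultiplicative.apply_iInf {n : ℕ} {f : (Fin n → Bool) → Bool}
    (hf : Supermultiplicative f) {ι : Type} {S : Set ι} (hS : S.Nonempty) (a : ι → Fin n → Bool)
    (ha : ∀ s ∈ S, f (a s) = true) {b : Fin n → Bool}
    (hb : ∀ i, b i = true ↔ ∀ s ∈ S, a s i = true) : f b = true := by
  have key : ∀ t : Finset (Fin n), ∃ c, f c = true ∧ (∀ i, b i = true → c i = true) ∧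
      ∀ i ∈ t, c i = true → b i = true := by
    intro t
    induction t using Finset.induction_on with
    | empty =>
      obtain ⟨s, hs⟩ := hS
      exact ⟨a s, ha s hs, fun i hi => (hb i).1 hi s hs, by simp⟩
    | insert j t _ ih =>
      obtain ⟨c, hc, hle, hge⟩ := ih
      by_cases hj : b j = true
      · refine ⟨c, hc, hle, fun i hi hci => ?_⟩
        rcases Finset.mem_insert.1 hi with rfl | hi
        · exact hj
        · exact hge i hi hci
      · obtain ⟨s, hs, hsj⟩ : ∃ s ∈ S, a s j ≠ true := by
          by_contra! hcon
          exact hj ((hb j).2 hcon)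
        refine ⟨fun i => c i && a s i, hf _ _ hc (ha s hs), fun i hi => ?_, fun i hi hci => ?_⟩
        · simp [hle i hi, (hb i).1 hi s hs]
        · rw [Bool.and_eq_true] at hci
          rcases Finset.mem_insert.1 hi with rfl | hi
          · exact absurd hci.2 hsj
          · exact hge i hi hci.1
  obtain ⟨c, hc, hle, hge⟩ := key Finset.univ
  have hbc : b = c := funext fun i =>
    Bool.eq_iff_iff.2 ⟨hle i, hge i (Finset.mem_univ i)⟩
  rwa [hbc]

namespace Kripke

variable {sig : Signature} {W U : Type} (K : Kripke sig W U) (w₀ : W)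

/-- The world reached from `w₀` along a list of moves, the latest move first. A move to a world
that is not accessible is ignored; the natural number labels copies of the same move. -/
noncomputable def endpoint : List (W × ℕ) → W
  | [] => w₀
  | e :: σ => if K.le (endpoint σ) e.1 then e.1 else endpoint σ

theorem endpoint_cons_of_le {σ : List (W × ℕ)} {u : W} (h : K.le (K.endpoint w₀ σ) u) (n : ℕ) :
    K.endpoint w₀ ((u, n) :: σ) = u := by
  simp [endpoint, h]

theorem le_endpoint_cons (e : W × ℕ) (σ : List (W × ℕ)) :
    K.le (K.endpoint w₀ σ) (K.endpoint w₀ (e :: σ)) := by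
  by_cases h : K.le (K.endpoint w₀ σ) e.1
  · simp [endpoint, h]
  · simpa [endpoint, h] using K.le_refl _

theorem endpoint_mono {σ τ : List (W × ℕ)} (h : σ <:+ τ) :
    K.le (K.endpoint w₀ σ) (K.endpoint w₀ τ) := by
  induction τ with
  | nil => rw [List.suffix_nil.1 h]; exact K.le_refl _
  | cons e τ ih =>
    rcases List.suffix_cons_iff.1 h with rfl | h
    · exact K.le_refl _
    · exact K.le_trans (ih h) (K.le_endpoint_cons w₀ e τ)

/-- A subtree of the tree of paths, with a root, containing almost all copies of each move from
each of its nodes. -/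
structure IsAmpleTree (S : Set (List (W × ℕ))) (r : List (W × ℕ)) : Prop where
  root_mem : r ∈ S
  eq_root_or_mem : ∀ {e σ}, e :: σ ∈ S → e :: σ = r ∨ σ ∈ S
  eventually_mem : ∀ {σ}, σ ∈ S → ∀ u : W, ∀ᶠ n in Filter.atTop, (u, n) :: σ ∈ S

/-- The functions selecting an individual at each path, unchanged along almost all copies of each
move. -/
def threads : Set (List (W × ℕ) → U) :=
  {f | (∀ σ, f σ ∈ K.D (K.endpoint w₀ σ)) ∧
    ∀ σ (u : W), ∀ᶠ n in Filter.atTop, f ((u, n) :: σ) = f σ}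

theorem const_mem_threads {d : U} (hd : d ∈ K.D w₀) : (fun _ => d) ∈ K.threads w₀ :=
  ⟨fun _ => K.D_mono (K.endpoint_mono w₀ (List.nil_suffix)) hd, by simp⟩

/-- The constant domain model whose worlds are the ample trees ordered by reverse inclusion, and
whose individuals are the threads; an atom is true at a tree if it is true at all its nodes. -/
noncomputable def unfolding :
    Kripke sig {S : Set (List (W × ℕ)) // ∃ r, IsAmpleTree S r} (List (W × ℕ) → U) where
  le S T := T.1 ⊆ S.1
  le_refl _ := subset_rfl
  le_trans h h' := h'.trans h
  D _ := K.threads w₀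
  D_nonempty _ := (K.D_nonempty w₀).elim fun _ hd => ⟨_, K.const_mem_threads w₀ hd⟩
  D_mono _ := subset_rfl
  I S p a := decide (∀ σ ∈ S.1, K.I (K.endpoint w₀ σ) p (fun i => a i σ) = true)
  hered := by
    intro S T hST p a _ h
    simp only [decide_eq_true_eq] at h ⊢
    exact fun σ hσ => h σ (hST hσ)

variable {K w₀}

theorem eventually_agree {ρ : ℕ → List (W × ℕ) → U} (hρ : ∀ x, ρ x ∈ K.threads w₀)
    (V : Finset ℕ) (σ : List (W × ℕ)) (u : W) :
    ∀ᶠ n in Filter.atTop, ∀ y ∈ V, ρ y ((u, n) :: σ) = ρ y σ :=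
  (Filter.eventually_all_finset V).2 fun y _ => (hρ y).2 σ u

theorem eventually_cons_ne (r σ : List (W × ℕ)) (u : W) :
    ∀ᶠ n in Filter.atTop, (u, n) :: σ ≠ r := by
  cases r with
  | nil => simp
  | cons e r =>
    filter_upwards [Filter.eventually_ne_atTop e.2] with n hn heq
    exact hn (by rw [← (List.cons.inj heq).1])

/-- The nodes of `S` above `σ` reached without changing the values of the variables in `V`. -/
def stableTree (S : Set (List (W × ℕ))) (ρ : ℕ → List (W × ℕ) → U) (V : Finset ℕ)
    (σ : List (W × ℕ)) : Set (List (W × ℕ)) :=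
  {τ | σ <:+ τ ∧ ∀ τ', σ <:+ τ' → τ' <:+ τ → τ' ∈ S ∧ ∀ y ∈ V, ρ y τ' = ρ y σ}

theorem isAmpleTree_stableTree {S : Set (List (W × ℕ))} {r : List (W × ℕ)} (hS : IsAmpleTree S r)
    {ρ : ℕ → List (W × ℕ) → U} (hρ : ∀ x, ρ x ∈ K.threads w₀) (V : Finset ℕ)
    {σ : List (W × ℕ)} (hσ : σ ∈ S) : IsAmpleTree (stableTree S ρ V σ) σ where
  root_mem := by
    refine ⟨List.suffix_rfl, fun τ h h' => ?_⟩
    obtain rfl : τ = σ := h'.eq_of_length_le h.length_le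
    exact ⟨hσ, fun _ _ => rfl⟩
  eq_root_or_mem := by
    rintro e τ ⟨hsuf, h⟩
    rcases List.suffix_cons_iff.1 hsuf with heq | hsuf
    · exact Or.inl heq.symm
    · exact Or.inr ⟨hsuf, fun τ' h₁ h₂ => h τ' h₁ (h₂.trans (List.suffix_cons e τ))⟩
  eventually_mem := by
    rintro τ ⟨hsuf, h⟩ u
    have hτ := h τ hsuf List.suffix_rfl
    filter_upwards [hS.eventually_mem hτ.1 u, eventually_agree hρ V τ u] with n hmem hagree
    refine ⟨hsuf.trans (List.suffix_cons _ τ), fun τ' h₁ h₂ => ?_⟩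
    rcases List.suffix_cons_iff.1 h₂ with rfl | h₂
    · exact ⟨hmem, fun y hy => (hagree y hy).trans (hτ.2 y hy)⟩
    · exact h τ' h₁ h₂

theorem exists_thread_eq {σ : List (W × ℕ)} {a : U} (ha : a ∈ K.D (K.endpoint w₀ σ)) :
    ∃ f ∈ K.threads w₀, f σ = a := by
  obtain ⟨d, hd⟩ := K.D_nonempty w₀
  refine ⟨fun τ => if σ <:+ τ then a else d, ⟨fun τ => ?_, fun τ u => ?_⟩,
    if_pos List.suffix_rfl⟩
  · by_cases h : σ <:+ τ
    · simpa only [if_pos h] using K.D_mono (K.endpoint_mono w₀ h) ha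
    · simpa only [if_neg h] using K.D_mono (K.endpoint_mono w₀ List.nil_suffix) hd
  · filter_upwards [eventually_cons_ne σ τ u] with n hn
    simp only [List.suffix_cons_iff, hn.symm, false_or]

/-- Individual witnesses at the nodes of an ample tree can be chosen to form a thread. -/
theorem exists_thread_of_forall_exists {S : Set (List (W × ℕ))} {r : List (W × ℕ)}
    (hS : IsAmpleTree S r) {ρ : ℕ → List (W × ℕ) → U} (hρ : ∀ x, ρ x ∈ K.threads w₀)
    (φ : Formula sig) (x : ℕ)
    (h : ∀ σ ∈ S, ∃ a ∈ K.D (K.endpoint w₀ σ),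
      val K φ (K.endpoint w₀ σ) (Function.update (fun y => ρ y σ) x a) = true) :
    ∃ f ∈ K.threads w₀, ∀ σ ∈ S,
      val K φ (K.endpoint w₀ σ) (Function.update (fun y => ρ y σ) x (f σ)) = true := by
  have hpick : ∀ σ, ∃ a ∈ K.D (K.endpoint w₀ σ), σ ∈ S →
      val K φ (K.endpoint w₀ σ) (Function.update (fun y => ρ y σ) x a) = true := by
    intro σ
    by_cases hσ : σ ∈ S
    · obtain ⟨a, ha, hval⟩ := h σ hσ
      exact ⟨a, ha, fun _ => hval⟩
    · obtain ⟨a, ha⟩ := K.D_nonempty (K.endpoint w₀ σ)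
      exact ⟨a, ha, fun hσ' => absurd hσ' hσ⟩
  choose pick hpickD hpickval using hpick
  let keep (e : W × ℕ) (τ : List (W × ℕ)) : Prop :=
    e :: τ ∈ S → τ ∈ S ∧ ∀ y ∈ φ.vars, ρ y (e :: τ) = ρ y τ
  let f : List (W × ℕ) → U := fun σ =>
    List.rec (pick []) (fun e τ b => if keep e τ then b else pick (e :: τ)) σ
  have hf_cons : ∀ e τ, f (e :: τ) = if keep e τ then f τ else pick (e :: τ) := fun _ _ => rfl
  have hfD : ∀ σ, f σ ∈ K.D (K.endpoint w₀ σ) := by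
    intro σ
    induction σ with
    | nil => exact hpickD []
    | cons e τ ih =>
      rw [hf_cons]
      split_ifs
      · exact K.D_mono (K.le_endpoint_cons w₀ e τ) ih
      · exact hpickD _
  refine ⟨f, ⟨hfD, fun τ u => ?_⟩, fun σ => ?_⟩
  · filter_upwards [eventually_cons_ne r τ u, eventually_agree hρ φ.vars τ u] with n hne hagree
    rw [hf_cons, if_pos]
    exact fun hmem => ⟨(hS.eq_root_or_mem hmem).resolve_left hne, hagree⟩
  · induction σ with
    | nil => exact hpickval []
    | cons e τ ih =>
      intro hmem
      rw [hf_cons]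
      split_ifs with hkeep
      · obtain ⟨hτ, hagree⟩ := hkeep hmem
        refine val_mono_of_agree K φ (K.le_endpoint_cons w₀ e τ)
          (update_mem (fun y => (hρ y).1 τ) x (hfD τ)) (fun y hy => ?_) (ih hτ)
        rcases eq_or_ne y x with rfl | hne
        · simp
        · simpa [hne] using hagree y hy
      · exact hpickval _ hmem

theorem update_eval {ι : Type} (ρ : ℕ → ι → U) (x : ℕ) (f : ι → U) (σ : ι) :
    (fun y => Function.update ρ x f y σ) = Function.update (fun y => ρ y σ) x (f σ) := by
  funext y
  rcases eq_or_ne y x with rfl | hne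
  · simp
  · simp [hne]

/-- Truth at an ample tree is truth at all its nodes. -/
theorem val_unfolding (hsup : ∀ c : sig.Conn, Supermultiplicative (sig.tt c)) (φ : Formula sig) :
    ∀ (S : {S : Set (List (W × ℕ)) // ∃ r, IsAmpleTree S r}) (ρ : ℕ → List (W × ℕ) → U),
      (∀ x, ρ x ∈ K.threads w₀) →
      (val (K.unfolding w₀) φ S ρ = true ↔
        ∀ σ ∈ S.1, val K φ (K.endpoint w₀ σ) (fun x => ρ x σ) = true) := by
  induction φ with
  | atom p args =>
    intro S ρ hρ
    simp only [val, unfolding, decide_eq_true_eq]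
  | conn c args ih =>
    intro S ρ hρ
    simp only [val, decide_eq_true_eq]
    constructor
    · intro h σ hσ u hu
      obtain ⟨r, hS⟩ := S.2
      obtain ⟨n, hmem, hagree⟩ := ((hS.eventually_mem hσ u).and
        (eventually_agree hρ (Formula.conn c args).vars σ u)).exists
      have hend := K.endpoint_cons_of_le w₀ hu n
      have hT := isAmpleTree_stableTree hS hρ (Formula.conn c args).vars hmem
      have hvars : ∀ i, ∀ y ∈ (args i).vars, y ∈ (Formula.conn c args).vars := fun i y hy => by
        simpa [Formula.vars] using ⟨i, hy⟩
      have hTval := h ⟨_, _, hT⟩ fun τ hτ => (hτ.2 τ hτ.1 List.suffix_rfl).1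
      convert hTval using 2
      funext i
      rw [Bool.eq_iff_iff, ih i _ ρ hρ, val_congr K (args i) u _ (fun y => ρ y ((u, n) :: σ))
        fun y hy => (hagree y (hvars i y hy)).symm]
      constructor
      · intro hval τ hτ
        refine val_mono_of_agree K (args i) (K.endpoint_mono w₀ hτ.1)
          (fun y => (hρ y).1 ((u, n) :: σ))
          (fun y hy => (hτ.2 τ hτ.1 List.suffix_rfl).2 y (hvars i y hy)) ?_
        rwa [hend]
      · intro hval
        simpa only [hend] using hval _ hT.root_mem
    · intro h T hT
      obtain ⟨r, hr⟩ := T.2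
      exact (hsup c).apply_iInf ⟨r, hr.root_mem⟩
        (fun σ i => val K (args i) (K.endpoint w₀ σ) fun x => ρ x σ)
        (fun σ hσ => h σ (hT hσ) _ (K.le_refl _)) fun i => ih i T ρ hρ
  | all x φ ih =>
    intro S ρ hρ
    simp only [val, decide_eq_true_eq]
    constructor
    · intro h σ hσ u hu a ha
      obtain ⟨r, hS⟩ := S.2
      obtain ⟨n, hmem, hagree⟩ := ((hS.eventually_mem hσ u).and
        (eventually_agree hρ φ.vars σ u)).exists
      have hend := K.endpoint_cons_of_le w₀ hu n
      obtain ⟨f, hf, hfa⟩ := exists_thread_eq (K := K) (w₀ := w₀) (σ := (u, n) :: σ)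
        (a := a) (by rwa [hend])
      have hval := (ih S _ (update_mem hρ x hf)).1
        (h S ((K.unfolding w₀).le_refl S) f hf) _ hmem
      rw [update_eval, hend, hfa] at hval
      rw [← hval]
      refine val_congr K φ u _ _ fun y hy => ?_
      rcases eq_or_ne y x with rfl | hne
      · simp
      · simpa [hne] using (hagree y hy).symm
    · intro h T hT f hf
      refine (ih T _ (update_mem hρ x hf)).2 fun σ hσ => ?_
      rw [update_eval]
      exact h σ (hT hσ) _ (K.le_refl _) _ (hf.1 σ)
  | ex x φ ih =>
    intro S ρ hρ
    simp only [val, decide_eq_true_eq]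
    constructor
    · rintro ⟨f, hf, hval⟩ σ hσ
      have hσval := (ih S _ (update_mem hρ x hf)).1 hval σ hσ
      rw [update_eval] at hσval
      exact ⟨f σ, hf.1 σ, hσval⟩
    · intro h
      obtain ⟨r, hS⟩ := S.2
      obtain ⟨f, hf, hval⟩ := exists_thread_of_forall_exists hS hρ φ x h
      refine ⟨f, hf, (ih S _ (update_mem hρ x hf)).2 fun σ hσ => ?_⟩
      rw [update_eval]
      exact hval σ hσ

theorem isAmpleTree_univ : IsAmpleTree (Set.univ : Set (List (W × ℕ))) [] :=
  ⟨Set.mem_univ _, fun _ => Or.inr (Set.mem_univ _), by simp⟩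

end Kripke

/-- If every connective in `C` is supermultiplicative, then every
sequent over `C` valid in all constant domain Kripke models is valid in all
Kripke models. -/
theorem FOCDS_subset_FOILS_of_supermultiplicative (sig : Signature)
    (hsup : ∀ c : sig.Conn, Supermultiplicative (sig.tt c))
    (Γ Δ : Set (Formula sig)) (h : FOCDS sig Γ Δ) :
    FOILS sig Γ Δ := by
  intro W U K w ρ hρ ⟨hΓ, hΔ⟩
  have hthread : ∀ x, (fun _ => ρ x) ∈ K.threads w := fun x => K.const_mem_threads w (hρ x)
  have hval := fun φ => Kripke.val_unfolding hsup φ ⟨_, _, Kripke.isAmpleTree_univ⟩ _ hthread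
  refine h _ _ (K.unfolding w) (fun _ _ => rfl) ⟨_, _, Kripke.isAmpleTree_univ⟩
    (fun x _ => ρ x) hthread ⟨fun φ hφ => ?_, fun φ hφ => ?_⟩
  · exact (hval φ).2 fun σ _ =>
      val_mono K φ (K.endpoint_mono w List.nil_suffix) hρ (hΓ φ hφ)
  · refine Bool.eq_false_iff.2 fun htrue => ?_
    have hroot := (hval φ).1 htrue [] (Set.mem_univ _)
    exact Bool.false_ne_true ((hΔ φ hφ).symm.trans hroot)
end

section
/- Let p be a unary predicate symbol, r a 0-ary predicate symbol (propositional symbol), and ⊕ the connective with truth function τ_⊕(x,y)=1 iff x ≠ y. The sequent ∀x(p(x) ⊕ r) ⇒ ∀x p(x) ⊕ r is valid in every Kripke model. -/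
open Classical

open Classical

/-- The signature whose only connective is exclusive disjunction `⊕`. -/
abbrev xorSig : Signature := ⟨Unit, fun _ => 2, fun _ a => Bool.xor (a 0) (a 1)⟩

/-- `p(x)`, where `p` is the unary predicate symbol `(0,1)` and `x` is variable `0`. -/
abbrev pAtom : Formula xorSig := .atom (0, 1) ![0]

/-- `r`, a 0-ary predicate symbol (propositional symbol), namely `(0,0)`. -/
abbrev rAtom : Formula xorSig := .atom (0, 0) ![]

section

variable {W U : Type} (K : Kripke xorSig W U) (w : W) (ρ : ℕ → U)

theorem val_pAtom : val K pAtom w ρ = K.I w (0, 1) ![ρ 0] := by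
  rw [val]
  congr 1
  ext i
  fin_cases i
  rfl

theorem val_rAtom : val K rAtom w ρ = K.I w (0, 0) ![] := by
  rw [val]
  congr 1
  exact Subsingleton.elim _ _

theorem val_xor (φ ψ : Formula xorSig) :
    val K (.conn () ![φ, ψ]) w ρ = true ↔ ∀ v, K.le w v → val K φ v ρ ≠ val K ψ v ρ := by
  simp [val]

theorem val_all (x : ℕ) (φ : Formula xorSig) :
    val K (.all x φ) w ρ = true ↔
      ∀ v, K.le w v → ∀ a ∈ K.D v, val K φ v (Function.update ρ x a) = true := by
  simp [val]

end

/-- The sequent `∀x(p(x) ⊕ r) ⇒ ∀x p(x) ⊕ r`, with `r` a 0-ary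
predicate symbol, is valid in every Kripke model. -/
theorem xor_D_sequent_Kripke_valid :
    FOILS xorSig {Formula.all 0 (.conn () ![pAtom, rAtom])}
        {Formula.conn () ![.all 0 pAtom, rAtom]} := by
  intro W U K w ρ _ ⟨hΓ, hΔ⟩
  have hxor : ∀ v, K.le w v → ∀ a ∈ K.D v, K.I v (0, 1) ![a] ≠ K.I v (0, 0) ![] := by
    intro v hv a ha
    have h := (val_all K w ρ _ _).1 (hΓ _ rfl) v hv a ha
    simpa [val_pAtom, val_rAtom] using (val_xor K v _ _ _).1 h v (K.le_refl v)
  refine Bool.eq_false_iff.1 (hΔ _ rfl) ((val_xor K w ρ _ _).2 fun v hv => ?_)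
  rw [val_rAtom, ne_eq, Bool.eq_iff_iff, val_all]
  simp only [val_pAtom, Function.update_self]
  cases hr : K.I v (0, 0) ![]
  · refine fun hiff => Bool.false_ne_true (hiff.1 fun u hu a ha => ?_)
    obtain ⟨b, hb⟩ := K.D_nonempty v
    have hwu := K.le_trans hv hu
    have hvb := hxor v hv b hb
    have hub := hxor u hwu b (K.D_mono hu hb)
    have hua := hxor u hwu a ha
    have hmono := K.hered hu (0, 1) ![b] (by simpa [Fin.forall_fin_one] using hb)
    revert hvb hub hua hmono
    rw [hr]
    cases K.I v (0, 1) ![b] <;> cases K.I u (0, 1) ![b] <;> cases K.I u (0, 0) ![] <;>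
      cases K.I u (0, 1) ![a] <;> decide
  · intro hiff
    obtain ⟨a, ha⟩ := K.D_nonempty v
    have hva := hxor v hv a ha
    exact hva ((hiff.2 rfl v (K.le_refl v) a ha).trans hr.symm)
end
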